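/- Let d be a positive integer. For every deterministic strategy (S,T) for the game J_d in which T is time-ordered (i.e., a deterministic strategy for the sequential game J'_d), the absolute value of the expected score is at most 2 · (3/4)^{d/4}. Consequently the classical bias of J'_d satisfies β^c(J'_d) ≤ 2 · (3/4)^{d/4}. -/

import Mathlib

/-- A function `T : {0,1}^{d+1} → {0,1}^{d+1}` is time-ordered if its `i`-th output bit
depends only on the input bits `y₁, …, yᵢ`. -/
def TimeOrdered {n : ℕ} (T : (Fin n → Bool) → (Fin n → Bool)) : Prop :=
  ∀ i : Fin n, ∀ y y' : Fin n → Bool, (∀ j : Fin n, j ≤ i → y j = y' j) → T y i = T y' i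

/-- The score in game `J_d` on inputs `x, y` and outputs `a, b`:  with
`uᵢ = xᵢ·(−1)^{aᵢ}` and `vᵢ = yᵢ + 2bᵢ` in `ℤ/4`, the score is `+1` if
`u·v ≡ 0 or 1 (mod 4)` and `−1` otherwise. -/
noncomputable def jScore (d : ℕ) (x y a b : Fin (d + 1) → Bool) : ℝ :=
  let u : Fin (d + 1) → ZMod 4 := fun i => (if x i then 1 else 0) * (if a i then -1 else 1)
  let v : Fin (d + 1) → ZMod 4 := fun i => (if y i then 1 else 0) + 2 * (if b i then 1 else 0)
  if (∑ i, u i * v i) = 0 ∨ (∑ i, u i * v i) = 1 then 1 else -1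

/-- The inputs of game `J_d`: bit strings of length `d+1` whose last bit is `1`. -/
def jInputs (d : ℕ) : Finset (Fin (d + 1) → Bool) :=
  Finset.univ.filter (fun x => x (Fin.last d) = true)

/-- The expected score `ω(J_d, (S,T))` of the deterministic strategy `(S, T)` for game `J_d`,
over inputs `x, y` uniform among bit strings with last bit `1`. -/
noncomputable def jExp (d : ℕ) (S T : (Fin (d + 1) → Bool) → (Fin (d + 1) → Bool)) : ℝ :=
  (∑ x ∈ jInputs d, ∑ y ∈ jInputs d, jScore d x y (S x) (T y)) / ((jInputs d).card : ℝ) ^ 2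

/-- The additive character `k ↦ i ^ k` of `ℤ/4`. -/
noncomputable def quarterChar (k : ZMod 4) : ℂ := Complex.I ^ k.val

theorem quarterChar_zero : quarterChar 0 = 1 := by simp [quarterChar]

theorem quarterChar_add (j k : ZMod 4) :
    quarterChar (j + k) = quarterChar j * quarterChar k := by
  rw [quarterChar, quarterChar, quarterChar, ZMod.val_add, ← pow_add, ← Complex.I_pow_eq_pow_mod]

theorem quarterChar_one : quarterChar 1 = Complex.I := by
  simp [quarterChar, show (1 : ZMod 4).val = 1 from rfl]

theorem quarterChar_two : quarterChar 2 = -1 := by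
  rw [show (2 : ZMod 4) = 1 + 1 by decide, quarterChar_add, quarterChar_one, Complex.I_mul_I]

theorem quarterChar_three : quarterChar 3 = -Complex.I := by
  rw [show (3 : ZMod 4) = 2 + 1 by decide, quarterChar_add, quarterChar_one, quarterChar_two,
    neg_one_mul]

/-- The element `y + 2b` of `ℤ/4` encoded by two bits. -/
def encode (y b : Bool) : ZMod 4 := (if y then 1 else 0) + 2 * (if b then 1 else 0)

/-- The element `x·(-1)^a` of `ℤ/4` encoded by two bits. -/
def signedBit (x a : Bool) : ZMod 4 := (if x then 1 else 0) * (if a then -1 else 1)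

theorem signedBit_injective {x x' a a' : Bool} (h : signedBit x a = signedBit x' a') :
    x = x' := by
  revert x x' a a'
  decide

/-- Reading the sign of the score off the character value. -/
theorem score_eq_re (k : ZMod 4) :
    (if k = 0 ∨ k = 1 then (1 : ℝ) else -1) = ((1 - Complex.I) * quarterChar k).re := by
  have h : k = 0 ∨ k = 1 ∨ k = 2 ∨ k = 3 := by revert k; decide
  rcases h with rfl | rfl | rfl | rfl
  · simp [quarterChar_zero]
  · simp [quarterChar_one]
  · rw [if_neg (by decide)]; simp [quarterChar_two]
  · rw [if_neg (by decide)]; simp [quarterChar_three]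

theorem sum_norm_pow_four_le (A B : ℂ) (s t : Bool) :
    ∑ w : ZMod 4, ‖quarterChar (w * encode false s) * A + quarterChar (w * encode true t) * B‖ ^ 4
      ≤ 6 * (‖A‖ ^ 2 + ‖B‖ ^ 2) ^ 2 := by
  have key : ∀ z : ℂ, ‖z‖ ^ 4 = (z.re ^ 2 + z.im ^ 2) ^ 2 := fun z => by
    rw [show ‖z‖ ^ 4 = (‖z‖ ^ 2) ^ 2 by ring, Complex.sq_norm, Complex.normSq_apply]; ring
  have hsum : ∀ f : ZMod 4 → ℝ, ∑ w, f w = f 0 + f 1 + f 2 + f 3 := fun f => Fin.sum_univ_four f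
  have e1 : ∀ b, encode false b = if b then 2 else 0 := by decide
  have e2 : ∀ b, encode true b = if b then 3 else 1 := by decide
  have m1 : (2 : ZMod 4) * 2 = 0 := by decide
  have m2 : (2 : ZMod 4) * 3 = 2 := by decide
  have m3 : (3 : ZMod 4) * 2 = 2 := by decide
  have m4 : (3 : ZMod 4) * 3 = 1 := by decide
  rw [hsum, Complex.sq_norm, Complex.sq_norm, Complex.normSq_apply, Complex.normSq_apply]
  simp only [key, e1, e2]
  cases s <;> cases t <;>
    simp [m1, m2, m3, m4, quarterChar_zero, quarterChar_one, quarterChar_two,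
      quarterChar_three] <;>
    nlinarith [sq_nonneg (A.re ^ 2 + A.im ^ 2 - (B.re ^ 2 + B.im ^ 2))]

theorem sum_add_sq_le {ι : Type*} (s : Finset ι) (a b : ι → ℝ) {C G H : ℝ} (hC : 0 ≤ C)
    (hG : 0 ≤ G) (hH : 0 ≤ H) (ha : ∑ i ∈ s, a i ^ 2 ≤ C * G ^ 2)
    (hb : ∑ i ∈ s, b i ^ 2 ≤ C * H ^ 2) :
    ∑ i ∈ s, (a i + b i) ^ 2 ≤ C * (G + H) ^ 2 := by
  have hab : ∑ i ∈ s, a i * b i ≤ C * G * H := by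
    refine le_of_sq_le_sq ?_ (by positivity)
    calc (∑ i ∈ s, a i * b i) ^ 2 ≤ (∑ i ∈ s, a i ^ 2) * ∑ i ∈ s, b i ^ 2 :=
          Finset.sum_mul_sq_le_sq_mul_sq s a b
      _ ≤ (C * G ^ 2) * (C * H ^ 2) :=
          mul_le_mul ha hb (Finset.sum_nonneg fun i _ => sq_nonneg _) (by positivity)
      _ = (C * G * H) ^ 2 := by ring
  have : ∑ i ∈ s, (a i + b i) ^ 2
      = ∑ i ∈ s, a i ^ 2 + 2 * ∑ i ∈ s, a i * b i + ∑ i ∈ s, b i ^ 2 := by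
    rw [Finset.mul_sum, ← Finset.sum_add_distrib, ← Finset.sum_add_distrib]
    exact Finset.sum_congr rfl fun i _ => by ring
  rw [this]
  nlinarith

theorem sum_cons {α M : Type*} [Fintype α] [AddCommMonoid M] {n : ℕ}
    (f : (Fin (n + 1) → α) → M) :
    ∑ y, f y = ∑ c, ∑ y, f (Fin.cons c y) := by
  rw [← (Fin.consEquiv fun _ => α).sum_comp, Fintype.sum_prod_type]
  rfl

theorem TimeOrdered.tail {n : ℕ} {T : (Fin (n + 1) → Bool) → (Fin (n + 1) → Bool)}
    (hT : TimeOrdered T) (c : Bool) :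
    TimeOrdered fun (y : Fin n → Bool) i => T (Fin.cons c y) i.succ := by
  intro i y y' h
  refine hT _ _ _ fun j hj => ?_
  cases j using Fin.cases with
  | zero => rfl
  | succ j => simpa using h j (by simpa using hj)

theorem TimeOrdered.castSucc {n : ℕ} {T : (Fin (n + 1) → Bool) → (Fin (n + 1) → Bool)}
    (hT : TimeOrdered T) (c : Bool) :
    TimeOrdered fun (y : Fin n → Bool) i =>
      T (Fin.snoc (α := fun _ => Bool) y c) i.castSucc := by
  intro i y y' h
  refine hT _ _ _ fun j hj => ?_
  cases j using Fin.lastCases with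
  | last => simp
  | cast j => simpa using h j (by simpa using hj)

/-- The transform of `g` along the strategy `T`, at frequency `w`. -/
noncomputable def strategyTransform {n : ℕ} (T : (Fin n → Bool) → (Fin n → Bool))
    (g : (Fin n → Bool) → ℂ) (w : Fin n → ZMod 4) : ℂ :=
  ∑ y, g y * quarterChar (∑ i, w i * encode (y i) (T y i))

theorem strategyTransform_cons {n : ℕ} {T : (Fin (n + 1) → Bool) → (Fin (n + 1) → Bool)}
    (hT : TimeOrdered T) (g : (Fin (n + 1) → Bool) → ℂ) (w₀ : ZMod 4) (w : Fin n → ZMod 4) :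
    strategyTransform T g (Fin.cons w₀ w) = ∑ c : Bool,
      quarterChar (w₀ * encode c (T (fun _ => c) 0)) *
        strategyTransform (fun y i => T (Fin.cons c y) i.succ) (fun y => g (Fin.cons c y)) w := by
  rw [strategyTransform, sum_cons]
  refine Finset.sum_congr rfl fun c _ => ?_
  rw [strategyTransform, Finset.mul_sum]
  refine Finset.sum_congr rfl fun y _ => ?_
  have h0 : T (Fin.cons c y) 0 = T (fun _ => c) 0 := hT 0 _ _ fun j hj => by
    rw [Fin.le_zero_iff.mp hj, Fin.cons_zero]
  rw [Fin.sum_univ_succ, quarterChar_add]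
  simp only [Fin.cons_zero, Fin.cons_succ, h0]
  ring

/-- The fourth moment of the transform along a time-ordered strategy. -/
theorem sum_norm_strategyTransform_pow_four_le {n : ℕ} :
    ∀ (T : (Fin n → Bool) → (Fin n → Bool)), TimeOrdered T → ∀ g : (Fin n → Bool) → ℂ,
      ∑ w, ‖strategyTransform T g w‖ ^ 4 ≤ 6 ^ n * (∑ y, ‖g y‖ ^ 2) ^ 2 := by
  induction n with
  | zero =>
    intro T _ g
    simp [strategyTransform, quarterChar_zero, ← pow_mul]
  | succ n ih =>
    intro T hT g
    let F : Bool → (Fin n → ZMod 4) → ℂ := fun c =>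
      strategyTransform (fun y i => T (Fin.cons c y) i.succ) (fun y => g (Fin.cons c y))
    let G : Bool → ℝ := fun c => ∑ y : Fin n → Bool, ‖g (Fin.cons c y)‖ ^ 2
    have hG : ∀ c, 0 ≤ G c := fun c => Finset.sum_nonneg fun y _ => sq_nonneg _
    have hF : ∀ c, ∑ w, (‖F c w‖ ^ 2) ^ 2 ≤ 6 ^ n * G c ^ 2 := fun c => by
      simpa only [← pow_mul] using ih _ (hT.tail c) fun y => g (Fin.cons c y)
    calc ∑ w, ‖strategyTransform T g w‖ ^ 4
        = ∑ w, ∑ w₀, ‖strategyTransform T g (Fin.cons w₀ w)‖ ^ 4 := by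
          rw [sum_cons, Finset.sum_comm]
      _ ≤ ∑ w, 6 * (‖F false w‖ ^ 2 + ‖F true w‖ ^ 2) ^ 2 := by
          refine Finset.sum_le_sum fun w _ => ?_
          refine le_trans (le_of_eq ?_) (sum_norm_pow_four_le (F false w) (F true w)
            (T (fun _ => false) 0) (T (fun _ => true) 0))
          refine Finset.sum_congr rfl fun w₀ _ => ?_
          rw [strategyTransform_cons hT, Fintype.sum_bool, add_comm]
      _ ≤ 6 * (6 ^ n * (G false + G true) ^ 2) := by
          rw [← Finset.mul_sum]
          exact mul_le_mul_of_nonneg_left (sum_add_sq_le _ _ _ (by positivity) (hG _) (hG _)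
            (hF _) (hF _)) (by norm_num)
      _ = 6 ^ (n + 1) * (∑ y, ‖g y‖ ^ 2) ^ 2 := by
          rw [sum_cons, Fintype.sum_bool]
          ring

/-- Summing the transform over frequencies whose parities are prescribed by `x`. -/
theorem sum_norm_strategyTransform_signedBit_pow_four_le {n : ℕ}
    {T : (Fin n → Bool) → (Fin n → Bool)} (hT : TimeOrdered T) (g : (Fin n → Bool) → ℂ)
    (hg : ∀ y, ‖g y‖ = 1) (S : (Fin n → Bool) → (Fin n → Bool)) :
    (∑ x, ‖strategyTransform T g fun i => signedBit (x i) (S x i)‖) ^ 4 ≤ 192 ^ n := by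
  have hinj : Function.Injective fun (x : Fin n → Bool) (i : Fin n) => signedBit (x i) (S x i) :=
    fun x x' h => funext fun i => signedBit_injective (congrFun h i)
  have h1 : ∑ x, ‖strategyTransform T g fun i => signedBit (x i) (S x i)‖ ^ 4
      ≤ ∑ w, ‖strategyTransform T g w‖ ^ 4 := by
    refine le_trans (le_of_eq ?_) (Finset.sum_le_sum_of_subset_of_nonneg
      (Finset.subset_univ (Finset.univ.map ⟨_, hinj⟩)) fun _ _ _ => by positivity)
    rw [Finset.sum_map]
    rfl
  have h2 := sum_norm_strategyTransform_pow_four_le T hT g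
  have h3 := pow_sum_div_card_le_sum_pow (s := Finset.univ)
    (f := fun x => ‖strategyTransform T g fun i => signedBit (x i) (S x i)‖)
    (fun x _ => norm_nonneg _) 3
  simp only [hg, one_pow, Finset.sum_const, Finset.card_univ, Fintype.card_fun, Fintype.card_bool,
    Fintype.card_fin, nsmul_eq_mul, mul_one] at h2 h3
  push_cast at h2 h3
  rw [div_le_iff₀ (by positivity)] at h3
  calc _ ≤ _ := h3
    _ ≤ 6 ^ n * (2 ^ n) ^ 2 * (2 ^ n) ^ 3 :=
        mul_le_mul_of_nonneg_right (h1.trans h2) (by positivity)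
    _ = 192 ^ n := by
        rw [mul_assoc, ← pow_add, ← pow_mul, mul_comm n, pow_mul, ← mul_pow]
        norm_num

theorem sum_jInputs {M : Type*} [AddCommMonoid M] (d : ℕ) (f : (Fin (d + 1) → Bool) → M) :
    ∑ x ∈ jInputs d, f x = ∑ x : Fin d → Bool, f (Fin.snoc (α := fun _ => Bool) x true) := by
  symm
  refine Finset.sum_bij (fun x _ => Fin.snoc (α := fun _ => Bool) x true) ?_ ?_ ?_ ?_
  · intro x _
    simp [jInputs]
  · intro x _ x' _ h
    exact (Fin.snoc_inj.mp h).1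
  · intro x hx
    have hx' : x (Fin.last d) = true := by simpa [jInputs] using hx
    exact ⟨Fin.init x, Finset.mem_univ _, by rw [← hx', Fin.snoc_init_self]⟩
  · intro x _
    rfl

theorem card_jInputs (d : ℕ) : (jInputs d).card = 2 ^ d := by
  rw [Finset.card_eq_sum_ones, sum_jInputs]
  simp

theorem quarterChar_last (a b : Bool) :
    quarterChar (signedBit true a * encode true b)
      = (if a then -1 else 1) * ((if b then -1 else 1) * Complex.I) := by
  have h1 : signedBit true a = if a then 3 else 1 := by revert a; decide
  have h2 : encode true b = if b then 3 else 1 := by revert b; decide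
  have h3 : (3 : ZMod 4) * 3 = 1 := by decide
  rw [h1, h2]
  cases a <;> cases b <;> simp [h3, quarterChar_one, quarterChar_three]

theorem jScore_eq_re (d : ℕ) (x y a b : Fin (d + 1) → Bool) :
    jScore d x y a b = ((1 - Complex.I) *
      quarterChar (∑ i, signedBit (x i) (a i) * encode (y i) (b i))).re :=
  score_eq_re _

theorem abs_jExp_pow_four_le (d : ℕ) (S T : (Fin (d + 1) → Bool) → (Fin (d + 1) → Bool))
    (hT : TimeOrdered T) : |jExp d S T| ^ 4 ≤ 4 * (3 / 4) ^ d := by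
  let ext : (Fin d → Bool) → (Fin (d + 1) → Bool) := fun x =>
    Fin.snoc (α := fun _ => Bool) x true
  let g : (Fin d → Bool) → ℂ := fun y =>
    (if T (ext y) (Fin.last d) then -1 else 1) * Complex.I
  let f : (Fin d → Bool) → ℂ := fun x => if S (ext x) (Fin.last d) then -1 else 1
  let F := strategyTransform (fun y i => T (ext y) i.castSucc) g
  let u : (Fin d → Bool) → Fin d → ZMod 4 := fun x i => signedBit (x i) (S (ext x) i.castSucc)
  have hg : ∀ y, ‖g y‖ = 1 := fun y => by
    simp only [g]; split_ifs <;> simp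
  have hf : ∀ x, ‖f x‖ = 1 := fun x => by
    simp only [f]; split_ifs <;> simp
  have hsum : ∑ x ∈ jInputs d, ∑ y ∈ jInputs d, jScore d x y (S x) (T y)
      = ((1 - Complex.I) * ∑ x, f x * F (u x)).re := by
    simp only [sum_jInputs, jScore_eq_re, ← Complex.re_sum, ← Finset.mul_sum]
    congr 2
    refine Finset.sum_congr rfl fun x _ => ?_
    simp only [F, strategyTransform, Finset.mul_sum]
    refine Finset.sum_congr rfl fun y _ => ?_
    rw [Fin.sum_univ_castSucc, quarterChar_add]
    simp only [Fin.snoc_castSucc, Fin.snoc_last, quarterChar_last, f, g, u, ext]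
    ring
  have hW : ‖∑ x, f x * F (u x)‖ ^ 4 ≤ 192 ^ d := by
    refine le_trans (pow_le_pow_left₀ (norm_nonneg _) ?_ 4)
      (sum_norm_strategyTransform_signedBit_pow_four_le (hT.castSucc true) g hg
        fun x i => S (ext x) i.castSucc)
    refine (norm_sum_le _ _).trans (Finset.sum_le_sum fun x _ => ?_)
    rw [norm_mul, hf, one_mul]
  have hI : ‖(1 - Complex.I : ℂ)‖ ^ 4 = 4 := by
    rw [show ‖(1 - Complex.I : ℂ)‖ ^ 4 = (‖(1 - Complex.I : ℂ)‖ ^ 2) ^ 2 by ring,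
      Complex.sq_norm, Complex.normSq_apply]
    norm_num
  have hden : (0 : ℝ) < (((2 : ℝ) ^ d) ^ 2) ^ 4 := by positivity
  rw [jExp, hsum, card_jInputs, abs_div, div_pow, abs_of_nonneg (sq_nonneg (_ : ℝ))]
  push_cast
  rw [div_le_iff₀ hden]
  calc _ ≤ ‖(1 - Complex.I) * ∑ x, f x * F (u x)‖ ^ 4 :=
        pow_le_pow_left₀ (abs_nonneg _) (Complex.abs_re_le_norm _) 4
    _ ≤ 4 * 192 ^ d := by
        rw [norm_mul, mul_pow, hI]
        exact mul_le_mul_of_nonneg_left hW (by norm_num)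
    _ = 4 * (3 / 4) ^ d * ((2 ^ d) ^ 2) ^ 4 := by
        rw [← pow_mul, ← pow_mul, mul_assoc, mul_comm d, pow_mul, ← mul_pow]
        norm_num

/-- Every deterministic strategy `(S,T)` for game `J_d` with `T`
time-ordered (i.e. a deterministic strategy for the sequential game `J'_d`) satisfies
`|ω(J_d,(S,T))| ≤ 2·(3/4)^{d/4}`; consequently the classical bias of `J'_d` is at most
`2·(3/4)^{d/4}`. -/
theorem stmt_13 (d : ℕ) (hd : 0 < d) :
    (∀ S T : (Fin (d + 1) → Bool) → (Fin (d + 1) → Bool), TimeOrdered T →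
      |jExp d S T| ≤ 2 * ((3 : ℝ) / 4) ^ ((d : ℝ) / 4)) ∧
    (⨆ p : {p : ((Fin (d + 1) → Bool) → (Fin (d + 1) → Bool)) ×
        ((Fin (d + 1) → Bool) → (Fin (d + 1) → Bool)) // TimeOrdered p.2},
      |jExp d p.1.1 p.1.2|) ≤ 2 * ((3 : ℝ) / 4) ^ ((d : ℝ) / 4) := by
  have h : ∀ S T : (Fin (d + 1) → Bool) → (Fin (d + 1) → Bool), TimeOrdered T →
      |jExp d S T| ≤ 2 * ((3 : ℝ) / 4) ^ ((d : ℝ) / 4) := by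
    intro S T hT
    refine le_of_pow_le_pow_left₀ (n := 4) (by norm_num) (by positivity) ?_
    have hr : (((3 : ℝ) / 4) ^ ((d : ℝ) / 4)) ^ 4 = (3 / 4) ^ d := by
      rw [← Real.rpow_natCast, ← Real.rpow_mul (by norm_num), ← Real.rpow_natCast]
      congr 1
      push_cast
      ring
    rw [mul_pow, hr]
    refine (abs_jExp_pow_four_le d S T hT).trans ?_
    gcongr
    norm_num
  exact ⟨h, Real.iSup_le (fun p => h _ _ p.2) (by positivity)⟩
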